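/- Fix integers s, d, m ≥ 1 with m ≥ 1, an index r ∈ {1,…,m}, vectors o_1,…,o_m ∈ ℝ^s, a matrix X ∈ ℝ^{s×d}, a vector b ∈ ℝ^d, and a scalar α ∈ ℝ. For each t ∈ {1,…,m}, let u_t ∈ ℝ^{s+m} be the concatenation of o_t with the t-th standard basis vector e_t of ℝ^m, and let N ∈ ℝ^{(s+m)×d} be X stacked on top of the m×d zero matrix. For a real parameter M and each p ∈ {1,…,m}, define λ_p(M) = exp(M · tanh(M · δ_{rp})) / ∑_{t=1}^m exp(M · tanh(M · δ_{rt})), and define v(M) = b + α · N^T (∑_{p=1}^m λ_p(M) · u_p) ∈ ℝ^d. Then v(M) converges to b + α · X^T o_r as M → ∞. In particular, for every ε > 0 there exists M such that ‖v(M) − (b + α · X^T o_r)‖ < ε. -/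

import Mathlib

open Real Matrix Filter

/-- If the score of `r` exceeds every other score by an amount tending to infinity, the softmax
weights converge to the indicator of `r`. -/
theorem tendsto_softmax_single {ι β : Type*} [Fintype ι] [DecidableEq ι] {l : Filter β}
    (z : β → ι → ℝ) (r : ι) (h : ∀ p, p ≠ r → Tendsto (fun x => z x r - z x p) l atTop) (p : ι) :
    Tendsto (fun x => Real.exp (z x p) / ∑ t, Real.exp (z x t)) l
      (nhds ((Pi.single r 1 : ι → ℝ) p)) := by
  have key : ∀ t, Tendsto (fun x => Real.exp (z x t - z x r)) l
      (nhds ((Pi.single r 1 : ι → ℝ) t)) := by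
    intro t
    by_cases ht : t = r
    · simp [ht, tendsto_const_nhds]
    · rw [Pi.single_eq_of_ne ht]
      refine Real.tendsto_exp_atBot.comp ?_
      exact (tendsto_neg_atTop_atBot.comp (h t ht)).congr fun x => neg_sub _ _
  have hsum := tendsto_finsetSum Finset.univ fun t _ => key t
  rw [Finset.sum_pi_single' r (1 : ℝ), if_pos (Finset.mem_univ r)] at hsum
  have hdiv := (key p).div hsum one_ne_zero
  rw [div_one] at hdiv
  refine hdiv.congr fun x => ?_
  simp only [Pi.div_apply, Real.exp_sub, ← Finset.sum_div]
  exact div_div_div_cancel_right₀ (Real.exp_ne_zero _) _ _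

theorem sub_one_le_mul_tanh (x : ℝ) : x - 1 ≤ x * Real.tanh x := by
  have hexp : Real.exp x = Real.exp (2 * x) * Real.exp (-x) := by
    rw [← Real.exp_add]
    ring_nf
  have hle : (2 * x + 1) * Real.exp (-x) ≤ Real.exp x := by
    rw [hexp]
    exact mul_le_mul_of_nonneg_right (Real.add_one_le_exp _) (Real.exp_pos _).le
  rw [Real.tanh_eq_sinh_div_cosh, ← mul_div_assoc, le_div_iff₀ (Real.cosh_pos x),
    Real.sinh_eq, Real.cosh_eq]
  linarith [Real.exp_pos (-x)]

theorem tendsto_mul_tanh_atTop : Tendsto (fun x : ℝ => x * Real.tanh x) atTop atTop := by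
  refine tendsto_atTop_mono sub_one_le_mul_tanh ?_
  exact tendsto_atTop_add_const_right atTop (-1 : ℝ) tendsto_id

/-- Padding a matrix with zero rows makes the product with its transpose ignore the entries
appended to a vector. -/
theorem transpose_append_zero_mulVec_append {s m d : ℕ} (X : Matrix (Fin s) (Fin d) ℝ)
    (x : Fin s → ℝ) (y : Fin m → ℝ) :
    (Matrix.of (Fin.append (fun i j => X i j) (fun (_ : Fin m) _ => (0 : ℝ))))ᵀ *ᵥ
      Fin.append x y = Xᵀ *ᵥ x := by
  ext j
  simp [Matrix.mulVec, dotProduct, Fin.sum_univ_add]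

/-- Theorem 1 of the GATNE paper made precise as a limit: with edge embeddings
`u_t` obtained by appending the one-hot indicator `e_t` to `o_t`, attention
weights `λ_p(M)` coming from the scores `M · tanh (M · δ_{rp})`, and
transformation matrix `N` equal to `X` padded with `m` zero rows, the
GATNE-T embedding `v(M) = b + α • Nᵀ (∑_p λ_p(M) • u_p)` converges to the MNE
embedding `b + α • Xᵀ o_r` as `M → ∞`; in particular it approximates it to
within any `ε > 0`. -/
theorem gatne_approximates_mne
    (s d m : ℕ) (hs : 1 ≤ s) (hd : 1 ≤ d) (hm : 1 ≤ m) (r : Fin m)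
    (o : Fin m → Fin s → ℝ) (X : Matrix (Fin s) (Fin d) ℝ)
    (b : Fin d → ℝ) (α : ℝ) :
    let u : Fin m → Fin (s + m) → ℝ :=
      fun t => Fin.append (o t) (fun k : Fin m => if t = k then (1 : ℝ) else 0)
    let N : Matrix (Fin (s + m)) (Fin d) ℝ :=
      Matrix.of (Fin.append (fun i j => X i j) (fun _ _ => (0 : ℝ)))
    let lam : ℝ → Fin m → ℝ := fun M p =>
      Real.exp (M * Real.tanh (M * (if r = p then (1 : ℝ) else 0))) /
        ∑ t : Fin m, Real.exp (M * Real.tanh (M * (if r = t then (1 : ℝ) else 0)))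
    let v : ℝ → Fin d → ℝ := fun M => b + α • (Nᵀ *ᵥ ∑ p : Fin m, lam M p • u p)
    Tendsto v atTop (nhds (b + α • (Xᵀ *ᵥ o r))) ∧
      ∀ ε > (0 : ℝ), ∃ M : ℝ, ‖v M - (b + α • (Xᵀ *ᵥ o r))‖ < ε := by
  intro u N lam v
  have hlam : ∀ p, Tendsto (fun M => lam M p) atTop (nhds ((Pi.single r 1 : Fin m → ℝ) p)) := by
    refine tendsto_softmax_single
      (fun M p => M * Real.tanh (M * (if r = p then (1 : ℝ) else 0))) r fun p hp => ?_
    simpa [hp.symm] using tendsto_mul_tanh_atTop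
  have hsum : Tendsto (fun M => ∑ p, lam M p • u p) atTop (nhds (u r)) := by
    have h := tendsto_finsetSum Finset.univ fun p _ => (hlam p).smul_const (u p)
    simpa [Pi.single_apply] using h
  have hv : Tendsto v atTop (nhds (b + α • (Xᵀ *ᵥ o r))) := by
    rw [← transpose_append_zero_mulVec_append X (o r) fun k => if r = k then (1 : ℝ) else 0]
    have hcont : Continuous fun w : Fin (s + m) → ℝ => b + α • (Nᵀ *ᵥ w) := by fun_prop
    exact (hcont.tendsto (u r)).comp hsum
  refine ⟨hv, fun ε hε => ?_⟩
  obtain ⟨M, hM⟩ := (Metric.tendsto_nhds.mp hv ε hε).exists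
  exact ⟨M, by rwa [← dist_eq_norm]⟩
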